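/- For every integer q and every real s with 1 < s ≤ q: (a) no solution α to OPT_q(s) is such that SUPP_q(α) contains an induced copy of the cycle C_5; and (b) there exists a solution α to OPT_q(s) such that SUPP_q(α) contains no induced copy of 3K_1 (three pairwise nonadjacent vertices), no induced copy of the cycle C_4, and no induced copy of C_5^+ (the five-vertex graph obtained from C_5 by adding one chord). -/

import Mathlib

/-- The nonempty subsets of `[q] = Fin q`, indexing the coordinates of our vectors. -/
def NEsets (q : ℕ) : Finset (Finset (Fin q)) :=
  Finset.univ.filter (fun A => A.Nonempty)

/-- The objective function `OBJ_q(α) = Σ_{A ≠ ∅} α_A log |A|`. -/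
noncomputable def objQ (q : ℕ) (α : Finset (Fin q) → ℝ) : ℝ :=
  ∑ A ∈ NEsets q, α A * Real.log (A.card : ℝ)

/-- The constraint function `V_q(α) = Σ_{A ≠ ∅} α_A`. -/
noncomputable def vQ (q : ℕ) (α : Finset (Fin q) → ℝ) : ℝ :=
  ∑ A ∈ NEsets q, α A

/-- The constraint function `E_q(α) = Σ_{{A,B} : A ∩ B = ∅} α_A α_B`, the sum being
over unordered pairs of disjoint nonempty sets. -/
noncomputable def eQ (q : ℕ) (α : Finset (Fin q) → ℝ) : ℝ :=
  (1 / 2) * ∑ A ∈ NEsets q, ∑ B ∈ NEsets q,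
    if Disjoint A B then α A * α B else 0

/-- The feasible set `FEAS_q(s)`: nonnegative vectors (indexed by nonempty subsets of
`[q]`, so the coordinate at `∅` is normalized to `0`) with `V_q(α) = 1` and
`E_q(α) ≥ (s-1)/(2s)`. -/
def Feas (q : ℕ) (s : ℝ) (α : Finset (Fin q) → ℝ) : Prop :=
  α ∅ = 0 ∧ (∀ A, 0 ≤ α A) ∧ vQ q α = 1 ∧ (s - 1) / (2 * s) ≤ eQ q α

/-- `α` is a solution to `OPT_q(s)`: it is feasible and maximizes `OBJ_q` over
`FEAS_q(s)`. -/
def IsSolution (q : ℕ) (s : ℝ) (α : Finset (Fin q) → ℝ) : Prop :=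
  Feas q s α ∧ ∀ β, Feas q s β → objQ q β ≤ objQ q α

/-- The support of `α`: the nonempty sets `A ⊆ [q]` with `α_A > 0`. -/
noncomputable def supp (q : ℕ) (α : Finset (Fin q) → ℝ) : Finset (Finset (Fin q)) :=
  @Finset.filter _ (fun A => 0 < α A) (Classical.decPred _) (NEsets q)

/-- `P` is a partition of `[q]` into nonempty parts. -/
def IsPartitionOf (q : ℕ) (P : Finset (Finset (Fin q))) : Prop :=
  (∀ A ∈ P, A.Nonempty) ∧ (∀ A ∈ P, ∀ B ∈ P, A ≠ B → Disjoint A B) ∧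
    P.biUnion id = Finset.univ

/-- `SUPP_q(α)` is in class `P_k`: the support of `α` is a partition of `[q]`
into `k` nonempty sets. -/
def ClassP (q k : ℕ) (α : Finset (Fin q) → ℝ) : Prop :=
  IsPartitionOf q (supp q α) ∧ (supp q α).card = k

/-- `SUPP_q(α)` is in class `Q_k`: the support of `α` consists of a partition
`A₁, …, A_k` of `[q]` into `k` nonempty sets together with the set `A₁ ∪ A₂`. -/
def ClassQ (q k : ℕ) (α : Finset (Fin q) → ℝ) : Prop :=
  ∃ P : Finset (Finset (Fin q)), ∃ A₁ ∈ P, ∃ A₂ ∈ P, A₁ ≠ A₂ ∧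
    IsPartitionOf q P ∧ P.card = k ∧ supp q α = insert (A₁ ∪ A₂) P

/-- `SUPP_q(α)` contains an induced copy of `3K_1` (three pairwise nonadjacent
vertices). -/
def Induced3K1 (q : ℕ) (α : Finset (Fin q) → ℝ) : Prop :=
  ∃ A : Fin 3 → Finset (Fin q), Function.Injective A ∧ (∀ i, A i ∈ supp q α) ∧
    ∀ i j, i ≠ j → ¬ Disjoint (A i) (A j)

/-- `SUPP_q(α)` contains an induced copy of the cycle `C_4`. -/
def InducedC4 (q : ℕ) (α : Finset (Fin q) → ℝ) : Prop :=
  ∃ A : Fin 4 → Finset (Fin q), Function.Injective A ∧ (∀ i, A i ∈ supp q α) ∧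
    ∀ i j, i ≠ j → (Disjoint (A i) (A j) ↔ (j = i + 1 ∨ i = j + 1))

/-- `SUPP_q(α)` contains an induced copy of the cycle `C_5`. -/
def InducedC5 (q : ℕ) (α : Finset (Fin q) → ℝ) : Prop :=
  ∃ A : Fin 5 → Finset (Fin q), Function.Injective A ∧ (∀ i, A i ∈ supp q α) ∧
    ∀ i j, i ≠ j → (Disjoint (A i) (A j) ↔ (j = i + 1 ∨ i = j + 1))

/-- `SUPP_q(α)` contains an induced copy of `C_5⁺`, the five-vertex graph obtained
from `C_5` by adding one chord. -/
def InducedC5plus (q : ℕ) (α : Finset (Fin q) → ℝ) : Prop :=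
  ∃ A : Fin 5 → Finset (Fin q), Function.Injective A ∧ (∀ i, A i ∈ supp q α) ∧
    ∀ i j, i ≠ j → (Disjoint (A i) (A j) ↔
      (j = i + 1 ∨ i = j + 1 ∨ (i = 0 ∧ j = 2) ∨ (i = 2 ∧ j = 0)))

/-- The symmetric bilinear form of the disjointness graph, so that
`eQ q α = disjForm q α α / 2`. -/
noncomputable def disjForm (q : ℕ) :
    (Finset (Fin q) → ℝ) →ₗ[ℝ] (Finset (Fin q) → ℝ) →ₗ[ℝ] ℝ :=
  LinearMap.mk₂ ℝ
    (fun α β => ∑ A ∈ NEsets q, ∑ B ∈ NEsets q, if Disjoint A B then α A * β B else 0)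
    (fun α α' β => by
      simp only [← Finset.sum_add_distrib]
      refine Finset.sum_congr rfl fun A _ => Finset.sum_congr rfl fun B _ => ?_
      split_ifs <;> simp [add_mul])
    (fun c α β => by
      simp only [smul_eq_mul, Finset.mul_sum]
      refine Finset.sum_congr rfl fun A _ => Finset.sum_congr rfl fun B _ => ?_
      split_ifs <;> simp [mul_assoc])
    (fun α β β' => by
      simp only [← Finset.sum_add_distrib]
      refine Finset.sum_congr rfl fun A _ => Finset.sum_congr rfl fun B _ => ?_
      split_ifs <;> simp [mul_add])
    (fun c α β => by
      simp only [smul_eq_mul, Finset.mul_sum]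
      refine Finset.sum_congr rfl fun A _ => Finset.sum_congr rfl fun B _ => ?_
      split_ifs
      · simp only [Pi.smul_apply, smul_eq_mul]; ring
      · simp)

lemma disjForm_apply (q : ℕ) (α β : Finset (Fin q) → ℝ) :
    disjForm q α β =
      ∑ A ∈ NEsets q, ∑ B ∈ NEsets q, if Disjoint A B then α A * β B else 0 := rfl

lemma disjForm_comm (q : ℕ) (α β : Finset (Fin q) → ℝ) :
    disjForm q α β = disjForm q β α := by
  rw [disjForm_apply, disjForm_apply, Finset.sum_comm]
  refine Finset.sum_congr rfl fun A _ => Finset.sum_congr rfl fun B _ => ?_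
  simp only [disjoint_comm, mul_comm]

lemma eQ_eq_disjForm (q : ℕ) (α : Finset (Fin q) → ℝ) :
    eQ q α = 1 / 2 * disjForm q α α := rfl

lemma eQ_add_smul (q : ℕ) (α δ : Finset (Fin q) → ℝ) (ε : ℝ) :
    eQ q (α + ε • δ) = eQ q α + ε * disjForm q α δ + ε ^ 2 / 2 * disjForm q δ δ := by
  simp only [eQ_eq_disjForm, map_add, map_smul, LinearMap.add_apply, LinearMap.smul_apply,
    smul_eq_mul, disjForm_comm q δ α]
  ring

lemma objQ_add_smul (q : ℕ) (α δ : Finset (Fin q) → ℝ) (ε : ℝ) :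
    objQ q (α + ε • δ) = objQ q α + ε * objQ q δ := by
  simp only [objQ, Finset.mul_sum, ← Finset.sum_add_distrib]
  exact Finset.sum_congr rfl fun A _ => by simp only [Pi.add_apply, Pi.smul_apply, smul_eq_mul]; ring

lemma vQ_add_smul (q : ℕ) (α δ : Finset (Fin q) → ℝ) (ε : ℝ) :
    vQ q (α + ε • δ) = vQ q α + ε * vQ q δ := by
  simp only [vQ, Finset.mul_sum, ← Finset.sum_add_distrib]
  exact Finset.sum_congr rfl fun A _ => by simp

lemma mem_NEsets {q : ℕ} {A : Finset (Fin q)} : A ∈ NEsets q ↔ A.Nonempty := by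
  simp [NEsets]

lemma mem_supp {q : ℕ} {α : Finset (Fin q) → ℝ} {A : Finset (Fin q)} :
    A ∈ supp q α ↔ A.Nonempty ∧ 0 < α A := by
  simp [supp, mem_NEsets]

lemma target_pos {s : ℝ} (hs : 1 < s) : 0 < (s - 1) / (2 * s) :=
  div_pos (by linarith) (by linarith)

/-- A feasible vector is not concentrated on `[q]`, so its objective is less than `log q`. -/
lemma objQ_lt_log {q : ℕ} {s : ℝ} (hs : 1 < s) {α : Finset (Fin q) → ℝ} (h : Feas q s α) :
    objQ q α < Real.log q := by
  obtain ⟨-, hnn, hv, he⟩ := h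
  have hlog : ∀ A ∈ NEsets q, α A * Real.log (A.card : ℝ) ≤ α A * Real.log q := by
    intro A hA
    have hc : (0 : ℝ) < A.card := by exact_mod_cast (mem_NEsets.1 hA).card_pos
    have hcq : (A.card : ℝ) ≤ q := by exact_mod_cast card_finset_fin_le A
    exact mul_le_mul_of_nonneg_left (Real.log_le_log hc hcq) (hnn A)
  have htot : ∑ A ∈ NEsets q, α A * Real.log q = Real.log q := by
    rw [← Finset.sum_mul]
    change vQ q α * _ = _
    rw [hv, one_mul]
  rw [← htot]
  refine Finset.sum_lt_sum hlog ?_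
  by_contra! hcon
  have hzero : ∀ A ∈ NEsets q, A ≠ Finset.univ → α A = 0 := by
    intro A hA hne
    by_contra h0
    have hpos : 0 < α A := lt_of_le_of_ne (hnn A) (Ne.symm h0)
    have hc : (0 : ℝ) < A.card := by exact_mod_cast (mem_NEsets.1 hA).card_pos
    have hcq : (A.card : ℝ) < q := by
      have := Finset.card_lt_card (Finset.ssubset_univ_iff.2 hne)
      simpa using this
    exact absurd (hcon A hA) (not_le.2 (mul_lt_mul_of_pos_left (Real.log_lt_log hc hcq) hpos))
  have hE : eQ q α = 0 := by
    rw [eQ, Finset.sum_eq_zero, mul_zero]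
    refine fun A hA => Finset.sum_eq_zero fun B hB => ?_
    split_ifs with hd
    · by_cases hAu : A = Finset.univ
      · have hBu : B ≠ Finset.univ := by
          rintro rfl
          subst hAu
          exact (mem_NEsets.1 hA).ne_empty (disjoint_self.1 hd)
        rw [hzero B hB hBu, mul_zero]
      · rw [hzero A hA hAu, zero_mul]
    · rfl
  exact absurd he (not_le.2 (hE ▸ target_pos hs))

/-- The edge constraint is tight at every solution. -/
lemma IsSolution.eQ_eq {q : ℕ} {s : ℝ} (hs : 1 < s) (hq : 0 < q) {α : Finset (Fin q) → ℝ}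
    (h : IsSolution q s α) : eQ q α = (s - 1) / (2 * s) := by
  by_contra hne
  have hlt : (s - 1) / (2 * s) < eQ q α := lt_of_le_of_ne h.1.2.2.2 (Ne.symm hne)
  have : NeZero q := ⟨hq.ne'⟩
  have huniv : (Finset.univ : Finset (Fin q)) ∈ NEsets q := mem_NEsets.2 Finset.univ_nonempty
  set e : Finset (Fin q) → ℝ := Pi.single Finset.univ 1 with he
  have hve : vQ q e = 1 := by
    simp [vQ, he, Pi.single_apply, huniv]
  have hoe : objQ q e = Real.log q := by
    simp [objQ, he, Pi.single_apply, huniv]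
  have hcont : ∀ᶠ η in nhdsWithin (0 : ℝ) (Set.Ioi 0), (s - 1) / (2 * s) <
      eQ q α + η * disjForm q α (e - α) + η ^ 2 / 2 * disjForm q (e - α) (e - α) := by
    have hc : Continuous fun η : ℝ =>
        eQ q α + η * disjForm q α (e - α) + η ^ 2 / 2 * disjForm q (e - α) (e - α) := by
      fun_prop
    exact (hc.continuousAt.eventually_const_lt (by simpa using hlt)).filter_mono nhdsWithin_le_nhds
  obtain ⟨η, hη, hη0, hη1⟩ := (hcont.and (Ioo_mem_nhdsGT (zero_lt_one' ℝ))).exists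
  have hvd : vQ q (e - α) = 0 := by
    have := vQ_add_smul q e α (-1)
    rw [neg_one_smul, ← sub_eq_add_neg, hve, h.1.2.2.1] at this
    linarith
  have hod : objQ q (e - α) = Real.log q - objQ q α := by
    have := objQ_add_smul q e α (-1)
    rw [neg_one_smul, ← sub_eq_add_neg, hoe] at this
    linarith
  have hfeas : Feas q s (α + η • (e - α)) := by
    refine ⟨?_, fun A => ?_, ?_, ?_⟩
    · simp [h.1.1, he, (mem_NEsets.1 huniv).ne_empty.symm]
    · have h1 : 0 ≤ e A := by
        rw [he, Pi.single_apply]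
        split_ifs <;> norm_num
      have h2 := h.1.2.1 A
      simp only [Pi.add_apply, Pi.smul_apply, Pi.sub_apply, smul_eq_mul]
      nlinarith [mul_nonneg hη0.le h1, mul_nonneg (sub_nonneg.2 hη1.le) h2]
    · rw [vQ_add_smul, hvd, h.1.2.2.1]; simp
    · rw [eQ_add_smul]; exact hη.le
  have := h.2 _ hfeas
  rw [objQ_add_smul, hod] at this
  nlinarith [objQ_lt_log hs h.1, mul_pos hη0 (sub_pos.2 (objQ_lt_log hs h.1))]

/-- Second-order optimality: a direction that lives on the support of a solution, preserves
`vQ`, preserves `eQ` to first order and does not decrease it to second order changes neither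
`objQ` nor `eQ`. -/
lemma IsSolution.direction_eq_zero {q : ℕ} {s : ℝ} (hs : 1 < s) (hq : 0 < q)
    {α δ : Finset (Fin q) → ℝ} (h : IsSolution q s α) (hsupp : ∀ A, δ A ≠ 0 → A ∈ supp q α)
    (hv : vQ q δ = 0) (h1 : disjForm q α δ = 0) (h2 : 0 ≤ disjForm q δ δ) :
    objQ q δ = 0 ∧ disjForm q δ δ = 0 := by
  have hnear : ∀ᶠ ε in nhdsWithin (0 : ℝ) (Set.Ioi 0),
      ∀ A, 0 ≤ α A + ε * δ A ∧ 0 ≤ α A + (-ε) * δ A := by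
    refine Filter.Eventually.filter_mono nhdsWithin_le_nhds (Filter.eventually_all.2 fun A => ?_)
    by_cases hA : δ A = 0
    · simp [hA, h.1.2.1 A]
    · have hpos := (mem_supp.1 (hsupp A hA)).2
      have c1 : Continuous fun ε : ℝ => α A + ε * δ A := by fun_prop
      have c2 : Continuous fun ε : ℝ => α A + (-ε) * δ A := by fun_prop
      filter_upwards [c1.continuousAt.eventually_const_lt (show 0 < α A + 0 * δ A by simpa),
        c2.continuousAt.eventually_const_lt (show 0 < α A + (-0) * δ A by simpa)] with ε k1 k2
      exact ⟨k1.le, k2.le⟩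
  obtain ⟨ε, hε, hε0⟩ := (hnear.and self_mem_nhdsWithin).exists
  have hε0 : 0 < ε := hε0
  have hδe : δ ∅ = 0 := by
    by_contra hne
    exact Finset.not_nonempty_empty (mem_supp.1 (hsupp _ hne)).1
  have hfeas : ∀ t : ℝ, (∀ A, 0 ≤ α A + t * δ A) → Feas q s (α + t • δ) := by
    refine fun t ht => ⟨by simp [h.1.1, hδe], ht, ?_, ?_⟩
    · rw [vQ_add_smul, hv, h.1.2.2.1]; simp
    · rw [eQ_add_smul, h1]
      have := h.1.2.2.2
      have : 0 ≤ t ^ 2 / 2 * disjForm q δ δ := by positivity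
      linarith
  have hf := hfeas ε fun A => (hε A).1
  have o1 := h.2 _ hf
  have o2 := h.2 _ (hfeas (-ε) fun A => (hε A).2)
  rw [objQ_add_smul] at o1 o2
  have ho : objQ q δ = 0 := by
    refine le_antisymm ?_ ?_
    · by_contra! hc
      nlinarith [mul_pos hε0 hc]
    · by_contra! hc
      nlinarith [mul_pos_of_neg_of_neg (neg_neg_of_pos hε0) hc]
  refine ⟨ho, ?_⟩
  have hsol : IsSolution q s (α + ε • δ) :=
    ⟨hf, fun β hβ => by rw [objQ_add_smul, ho, mul_zero, add_zero]; exact h.2 β hβ⟩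
  have e1 := hsol.eQ_eq hs hq
  rw [eQ_add_smul, h1, h.eQ_eq hs hq, mul_zero, add_zero, add_eq_left] at e1
  exact (mul_eq_zero.1 e1).resolve_left (by positivity)

/-- Moving a solution along a neutral direction until a coordinate vanishes. -/
lemma IsSolution.exists_supp_ssubset {q : ℕ} {s : ℝ} {α δ : Finset (Fin q) → ℝ}
    (h : IsSolution q s α) (hsupp : ∀ A, δ A ≠ 0 → A ∈ supp q α) (hδ : δ ≠ 0)
    (hv : vQ q δ = 0) (ho : objQ q δ = 0) (h1 : disjForm q α δ = 0)
    (h2 : disjForm q δ δ = 0) : ∃ β, IsSolution q s β ∧ supp q β ⊂ supp q α := by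
  classical
  obtain ⟨A₀, hA₀⟩ := Function.ne_iff.1 hδ
  have hneg : ((NEsets q).filter fun A => δ A < 0).Nonempty := by
    by_contra hcon
    have hnn : ∀ A ∈ NEsets q, 0 ≤ δ A := fun A hA => by
      by_contra! hlt
      exact hcon ⟨A, Finset.mem_filter.2 ⟨hA, hlt⟩⟩
    exact hA₀ ((Finset.sum_eq_zero_iff_of_nonneg hnn).1 hv A₀
      (mem_NEsets.2 (mem_supp.1 (hsupp A₀ hA₀)).1))
  obtain ⟨M, hM, hmin⟩ := Finset.exists_min_image _ (fun A => α A / -δ A) hneg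
  have hMneg := (Finset.mem_filter.1 hM).2
  have hMsupp := hsupp M hMneg.ne
  set ε := α M / -δ M with hεdef
  have hε : 0 ≤ ε := div_nonneg (h.1.2.1 M) (by linarith)
  have hMzero : α M + ε * δ M = 0 := by
    rw [hεdef]
    field_simp [hMneg.ne]
    ring
  have hδz : ∀ A, A ∉ supp q α → δ A = 0 := fun A hA => by_contra fun hne => hA (hsupp A hne)
  have hnn : ∀ A, 0 ≤ α A + ε * δ A := by
    intro A
    rcases le_or_gt 0 (δ A) with hA | hA
    · exact add_nonneg (h.1.2.1 A) (mul_nonneg hε hA)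
    · have := hmin A (Finset.mem_filter.2
        ⟨mem_NEsets.2 (mem_supp.1 (hsupp A hA.ne)).1, hA⟩)
      rw [le_div_iff₀ (by linarith)] at this
      linarith
  refine ⟨α + ε • δ, ⟨⟨?_, hnn, ?_, ?_⟩, fun β hβ => ?_⟩, ?_⟩
  · have : δ ∅ = 0 := hδz ∅ fun hmem => Finset.not_nonempty_empty (mem_supp.1 hmem).1
    simp [h.1.1, this]
  · rw [vQ_add_smul, hv, h.1.2.2.1]; simp
  · rw [eQ_add_smul, h1, h2]; simpa using h.1.2.2.2
  · rw [objQ_add_smul, ho, mul_zero, add_zero]; exact h.2 β hβ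
  · refine Finset.ssubset_iff_subset_ne.2 ⟨fun A hA => ?_, fun heq => ?_⟩
    · by_contra hnot
      obtain ⟨hne, hpos⟩ := mem_supp.1 hA
      refine hnot (mem_supp.2 ⟨hne, ?_⟩)
      simpa [hδz A hnot] using hpos
    · rw [← heq] at hMsupp
      exact (mem_supp.1 hMsupp).2.ne' hMzero

/-- The vector with coordinate `c i` at `A i` (for injective `A`) and `0` elsewhere. -/
noncomputable def placed {q n : ℕ} (A : Fin n → Finset (Fin q)) (c : Fin n → ℝ) :
    Finset (Fin q) → ℝ :=
  ∑ i, c i • Pi.single (A i) 1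

lemma placed_add_smul {q n : ℕ} (A : Fin n → Finset (Fin q)) (u v : Fin n → ℝ) (x y : ℝ) :
    placed A (x • u + y • v) = x • placed A u + y • placed A v := by
  simp [placed, Finset.smul_sum, ← Finset.sum_add_distrib, add_smul, mul_smul]

lemma placed_apply {q n : ℕ} {A : Fin n → Finset (Fin q)} (hA : Function.Injective A)
    (c : Fin n → ℝ) (i : Fin n) : placed A c (A i) = c i := by
  simp [placed, Finset.sum_apply, Pi.single_apply, hA.eq_iff]

lemma exists_of_placed_ne_zero {q n : ℕ} {A : Fin n → Finset (Fin q)} {c : Fin n → ℝ}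
    {B : Finset (Fin q)} (h : placed A c B ≠ 0) : ∃ i, A i = B := by
  by_contra! hcon
  apply h
  simp only [placed, Finset.sum_apply, Pi.smul_apply, smul_eq_mul]
  exact Finset.sum_eq_zero fun i _ => by rw [Pi.single_eq_of_ne' (hcon i), mul_zero]

lemma vQ_placed {q n : ℕ} {A : Fin n → Finset (Fin q)} (hA : ∀ i, A i ∈ NEsets q)
    (c : Fin n → ℝ) : vQ q (placed A c) = ∑ i, c i := by
  simp only [vQ, placed, Finset.sum_apply, Pi.smul_apply, smul_eq_mul]
  rw [Finset.sum_comm]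
  exact Finset.sum_congr rfl fun i _ => by simp [Pi.single_apply, hA i]

lemma disjForm_placed {q n : ℕ} {A : Fin n → Finset (Fin q)} (hA : ∀ i, A i ∈ NEsets q)
    (c : Fin n → ℝ) : disjForm q (placed A c) (placed A c) =
      ∑ i, ∑ j, if Disjoint (A i) (A j) then c i * c j else 0 := by
  have hsingle : ∀ i j, disjForm q (Pi.single (A i) 1) (Pi.single (A j) 1) =
      if Disjoint (A i) (A j) then 1 else 0 := by
    intro i j
    rw [disjForm_apply, Finset.sum_eq_single (A i), Finset.sum_eq_single (A j)]
    · simp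
    · intro B _ hB
      simp [hB]
    · exact fun hn => absurd (hA j) hn
    · intro B _ hB
      simp [hB]
    · exact fun hn => absurd (hA i) hn
  simp only [placed, map_sum, LinearMap.sum_apply, map_smul, LinearMap.smul_apply, hsingle,
    smul_eq_mul, Finset.mul_sum]
  rw [Finset.sum_comm]
  refine Finset.sum_congr rfl fun i _ => Finset.sum_congr rfl fun j _ => ?_
  split_ifs <;> ring

/-- For a solution whose support contains the sets `A i`, a plane of zero-sum weights on the
`A i` that is nonnegative for the disjointness form contains a nonzero neutral direction. -/
lemma IsSolution.exists_neutral {q n : ℕ} {s : ℝ} (hs : 1 < s) (hq : 0 < q)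
    {α : Finset (Fin q) → ℝ} (h : IsSolution q s α) {A : Fin n → Finset (Fin q)}
    (hA : ∀ i, A i ∈ supp q α) {u v : Fin n → ℝ} (hu : ∑ i, u i = 0) (hv : ∑ i, v i = 0)
    (hpos : ∀ x y : ℝ, 0 ≤ ∑ i, ∑ j, if Disjoint (A i) (A j) then
      (x * u i + y * v i) * (x * u j + y * v j) else 0) :
    ∃ x y : ℝ, (x ≠ 0 ∨ y ≠ 0) ∧ vQ q (placed A (x • u + y • v)) = 0 ∧
      objQ q (placed A (x • u + y • v)) = 0 ∧ disjForm q α (placed A (x • u + y • v)) = 0 ∧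
      disjForm q (placed A (x • u + y • v)) (placed A (x • u + y • v)) = 0 := by
  have hNE : ∀ i, A i ∈ NEsets q := fun i => mem_NEsets.2 (mem_supp.1 (hA i)).1
  obtain ⟨x, y, hxy, hker⟩ : ∃ x y : ℝ, (x ≠ 0 ∨ y ≠ 0) ∧
      disjForm q α (placed A (x • u + y • v)) = 0 := by
    simp only [placed_add_smul, map_add, map_smul, smul_eq_mul]
    by_cases hu0 : disjForm q α (placed A u) = 0
    · exact ⟨1, 0, by simp [hu0]⟩
    · exact ⟨disjForm q α (placed A v), -disjForm q α (placed A u),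
        Or.inr (neg_ne_zero.2 hu0), by ring⟩
  have hsum : vQ q (placed A (x • u + y • v)) = 0 := by
    rw [vQ_placed hNE]
    simp [Finset.sum_add_distrib, ← Finset.mul_sum, hu, hv]
  obtain ⟨ho, hd⟩ := h.direction_eq_zero hs hq (fun B hB => by
    obtain ⟨i, rfl⟩ := exists_of_placed_ne_zero hB
    exact hA i) hsum hker (by rw [disjForm_placed hNE]; exact hpos x y)
  exact ⟨x, y, hxy, hsum, ho, hker, hd⟩

/-- A solution of minimal support admits no such plane of weights. -/
lemma IsSolution.exists_smaller {q n : ℕ} {s : ℝ} (hs : 1 < s) (hq : 0 < q)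
    {α : Finset (Fin q) → ℝ} (h : IsSolution q s α) {A : Fin n → Finset (Fin q)}
    (hinj : Function.Injective A) (hA : ∀ i, A i ∈ supp q α) {u v : Fin n → ℝ}
    (hu : ∑ i, u i = 0) (hv : ∑ i, v i = 0)
    (hind : ∀ x y : ℝ, (∀ i, x * u i + y * v i = 0) → x = 0 ∧ y = 0)
    (hpos : ∀ x y : ℝ, 0 ≤ ∑ i, ∑ j, if Disjoint (A i) (A j) then
      (x * u i + y * v i) * (x * u j + y * v j) else 0) :
    ∃ β, IsSolution q s β ∧ supp q β ⊂ supp q α := by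
  obtain ⟨x, y, hxy, hsum, ho, hker, hd⟩ := h.exists_neutral hs hq hA hu hv hpos
  refine h.exists_supp_ssubset (fun B hB => ?_) (fun h0 => ?_) hsum ho hker hd
  · obtain ⟨i, rfl⟩ := exists_of_placed_ne_zero hB
    exact hA i
  · have := hind x y fun i => by
      have := placed_apply hinj (x • u + y • v) i
      rw [h0] at this
      simpa using this.symm
    tauto

lemma not_disjoint_self_of_mem_supp {q : ℕ} {α : Finset (Fin q) → ℝ} {A : Finset (Fin q)}
    (h : A ∈ supp q α) : ¬ Disjoint A A := fun hd =>
  (mem_supp.1 h).1.ne_empty (disjoint_self.1 hd)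

lemma not_inducedC5_of_isSolution {q : ℕ} {s : ℝ} (hs : 1 < s) (hq : 0 < q)
    {α : Finset (Fin q) → ℝ} (h : IsSolution q s α) : ¬ InducedC5 q α := by
  rintro ⟨A, -, hA, hadj⟩
  have hform : ∀ x y : ℝ, (∑ i, ∑ j, if Disjoint (A i) (A j) then
      (x * ![2, 0, -1, -1, 0] i + y * ![0, 1, 1, -1, -1] i) *
        (x * ![2, 0, -1, -1, 0] j + y * ![0, 1, 1, -1, -1] j) else 0) =
      2 * (x ^ 2 + y ^ 2) := by
    intro x y
    have hd : ∀ i j, Disjoint (A i) (A j) ↔ (j = i + 1 ∨ i = j + 1) := by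
      intro i j
      by_cases hij : i = j
      · subst hij
        exact iff_of_false (not_disjoint_self_of_mem_supp (hA i)) (by decide +revert)
      · exact hadj i j hij
    simp only [hd, Fin.sum_univ_five]
    simp +decide
    ring
  obtain ⟨x, y, hxy, -, -, -, hd⟩ := h.exists_neutral hs hq hA
    (u := ![2, 0, -1, -1, 0]) (v := ![0, 1, 1, -1, -1])
    (by simp [Fin.sum_univ_five]; norm_num) (by simp [Fin.sum_univ_five])
    (fun x y => by rw [hform]; positivity)
  rw [disjForm_placed fun i => mem_NEsets.2 (mem_supp.1 (hA i)).1] at hd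
  have := (hform x y).symm.trans hd
  rcases hxy with hx | hy
  · have := sq_pos_of_ne_zero hx
    nlinarith [sq_nonneg y]
  · have := sq_pos_of_ne_zero hy
    nlinarith [sq_nonneg x]

lemma IsSolution.exists_smaller_of_induced3K1 {q : ℕ} {s : ℝ} (hs : 1 < s) (hq : 0 < q)
    {α : Finset (Fin q) → ℝ} (h : IsSolution q s α) (hK : Induced3K1 q α) :
    ∃ β, IsSolution q s β ∧ supp q β ⊂ supp q α := by
  obtain ⟨A, hinj, hA, hadj⟩ := hK
  have hd : ∀ i j, ¬ Disjoint (A i) (A j) := by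
    intro i j
    by_cases hij : i = j
    · exact hij ▸ not_disjoint_self_of_mem_supp (hA i)
    · exact hadj i j hij
  refine h.exists_smaller hs hq hinj hA (u := ![1, -1, 0]) (v := ![0, 1, -1])
    (by simp [Fin.sum_univ_three]) (by simp [Fin.sum_univ_three])
    (fun x y hxy => ?_) (fun x y => by simp [hd])
  have h0 := hxy 0
  have h2 := hxy 2
  simp at h0 h2
  exact ⟨h0, h2⟩

lemma IsSolution.exists_smaller_of_inducedC4 {q : ℕ} {s : ℝ} (hs : 1 < s) (hq : 0 < q)
    {α : Finset (Fin q) → ℝ} (h : IsSolution q s α) (hC : InducedC4 q α) :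
    ∃ β, IsSolution q s β ∧ supp q β ⊂ supp q α := by
  obtain ⟨A, hinj, hA, hadj⟩ := hC
  have hd : ∀ i j, Disjoint (A i) (A j) ↔ (j = i + 1 ∨ i = j + 1) := by
    intro i j
    by_cases hij : i = j
    · subst hij
      exact iff_of_false (not_disjoint_self_of_mem_supp (hA i)) (by decide +revert)
    · exact hadj i j hij
  refine h.exists_smaller hs hq hinj hA (u := ![1, 0, -1, 0]) (v := ![0, 1, 0, -1])
    (by simp [Fin.sum_univ_four]) (by simp [Fin.sum_univ_four])
    (fun x y hxy => ?_) (fun x y => ?_)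
  · have h0 := hxy 0
    have h1 := hxy 1
    simp at h0 h1
    exact ⟨h0, h1⟩
  · simp only [hd, Fin.sum_univ_four]
    simp +decide

lemma IsSolution.exists_smaller_of_inducedC5plus {q : ℕ} {s : ℝ} (hs : 1 < s) (hq : 0 < q)
    {α : Finset (Fin q) → ℝ} (h : IsSolution q s α) (hC : InducedC5plus q α) :
    ∃ β, IsSolution q s β ∧ supp q β ⊂ supp q α := by
  obtain ⟨A, hinj, hA, hadj⟩ := hC
  have hd : ∀ i j, Disjoint (A i) (A j) ↔
      (j = i + 1 ∨ i = j + 1 ∨ (i = 0 ∧ j = 2) ∨ (i = 2 ∧ j = 0)) := by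
    intro i j
    by_cases hij : i = j
    · subst hij
      exact iff_of_false (not_disjoint_self_of_mem_supp (hA i)) (by decide +revert)
    · exact hadj i j hij
  refine h.exists_smaller hs hq hinj hA (u := ![-1, 0, 1, 1, -1]) (v := ![0, -2, 0, 1, 1])
    (by simp [Fin.sum_univ_five]) (by simp [Fin.sum_univ_five]; norm_num)
    (fun x y hxy => ?_) (fun x y => ?_)
  · have h0 := hxy 0
    have h1 := hxy 1
    simp at h0 h1
    exact ⟨h0, h1⟩
  · simp only [hd, Fin.sum_univ_five]
    simp +decide
    nlinarith [sq_nonneg y]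

lemma exists_feas {q : ℕ} {s : ℝ} (hs : 1 < s) (hsq : s ≤ q) : ∃ α, Feas q s α := by
  have hq : (0 : ℝ) < q := by linarith
  have hinj : Function.Injective fun i : Fin q => ({i} : Finset (Fin q)) :=
    Finset.singleton_injective
  have hNE : ∀ i : Fin q, ({i} : Finset (Fin q)) ∈ NEsets q := fun i =>
    mem_NEsets.2 (Finset.singleton_nonempty i)
  refine ⟨placed (fun i => {i}) fun _ => (q : ℝ)⁻¹, ?_, fun B => ?_, ?_, ?_⟩
  · by_contra hne
    obtain ⟨i, hi⟩ := exists_of_placed_ne_zero hne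
    exact Finset.singleton_ne_empty i hi
  · by_cases hB : placed (fun i : Fin q => {i}) (fun _ => (q : ℝ)⁻¹) B = 0
    · exact hB.ge
    · obtain ⟨i, rfl⟩ := exists_of_placed_ne_zero hB
      rw [placed_apply hinj]
      positivity
  · rw [vQ_placed hNE]
    simp [hq.ne']
  · rw [eQ_eq_disjForm, disjForm_placed hNE]
    have hrow : ∀ i : Fin q, (∑ j : Fin q, if Disjoint ({i} : Finset (Fin q)) {j} then
        (q : ℝ)⁻¹ * (q : ℝ)⁻¹ else 0) = (q - 1) * ((q : ℝ)⁻¹ * (q : ℝ)⁻¹) := by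
      intro i
      have : ∀ j : Fin q, (if Disjoint ({i} : Finset (Fin q)) {j} then
          (q : ℝ)⁻¹ * (q : ℝ)⁻¹ else 0) =
          (q : ℝ)⁻¹ * (q : ℝ)⁻¹ - if i = j then (q : ℝ)⁻¹ * (q : ℝ)⁻¹ else 0 := by
        intro j
        by_cases hij : i = j <;> simp [hij]
      simp only [this, Finset.sum_sub_distrib, Finset.sum_ite_eq, Finset.mem_univ, if_true,
        Finset.sum_const, Finset.card_univ, Fintype.card_fin, nsmul_eq_mul]
      ring
    simp only [hrow, Finset.sum_const, Finset.card_univ, Fintype.card_fin, nsmul_eq_mul]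
    have e1 : (s - 1) / (2 * s) = 1 / 2 * (1 - s⁻¹) := by
      field_simp
    have e2 : 1 / 2 * ((q : ℝ) * ((q - 1) * ((q : ℝ)⁻¹ * (q : ℝ)⁻¹))) =
        1 / 2 * (1 - (q : ℝ)⁻¹) := by
      field_simp
    rw [e1, e2]
    have : (q : ℝ)⁻¹ ≤ s⁻¹ := inv_anti₀ (by linarith) hsq
    linarith

lemma exists_isSolution {q : ℕ} {s : ℝ} (hs : 1 < s) (hsq : s ≤ q) :
    ∃ α, IsSolution q s α := by
  have hclosed : IsClosed {α | Feas q s α} := by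
    have hE : Continuous fun α => eQ q α := by
      unfold eQ
      refine continuous_const.mul (continuous_finsetSum _ fun A _ =>
        continuous_finsetSum _ fun B _ => ?_)
      split_ifs <;> fun_prop
    have hV : Continuous fun α => vQ q α := by
      unfold vQ
      fun_prop
    have hnn : IsClosed {α : Finset (Fin q) → ℝ | ∀ A, 0 ≤ α A} := by
      simp only [Set.ofPred_forall]
      exact isClosed_iInter fun A => isClosed_le continuous_const (continuous_apply A)
    exact (isClosed_eq (continuous_apply ∅) continuous_const).inter
      (hnn.inter ((isClosed_eq hV continuous_const).inter (isClosed_le continuous_const hE)))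
  have hsub : {α | Feas q s α} ⊆ Set.Icc 0 1 := by
    rintro α ⟨h0, hnn, hv, -⟩
    refine ⟨hnn, fun A => ?_⟩
    by_cases hA : A.Nonempty
    · rw [Pi.one_apply, ← hv]
      exact Finset.single_le_sum (fun B _ => hnn B) (mem_NEsets.2 hA)
    · rw [Finset.not_nonempty_iff_eq_empty.1 hA, h0]
      exact zero_le_one
  have hO : Continuous fun α => objQ q α := by
    unfold objQ
    fun_prop
  obtain ⟨α, hα, hmax⟩ := (isCompact_Icc.of_isClosed_subset hclosed hsub).exists_isMaxOn
    (exists_feas hs hsq) hO.continuousOn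
  exact ⟨α, hα, fun β hβ => hmax hβ⟩

/-- (a) No solution to `OPT_q(s)` has an induced `C_5` in its support graph;
(b) some solution to `OPT_q(s)` has no induced `3K_1`, `C_4`, or `C_5⁺` in its
support graph. -/
theorem forbidden_induced_subgraphs (q : ℕ) (s : ℝ) (hs : 1 < s) (hsq : s ≤ q) :
    (∀ α : Finset (Fin q) → ℝ, IsSolution q s α → ¬ InducedC5 q α) ∧
    (∃ α : Finset (Fin q) → ℝ, IsSolution q s α ∧
      ¬ Induced3K1 q α ∧ ¬ InducedC4 q α ∧ ¬ InducedC5plus q α) := by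
  have hq : 0 < q := by
    have : (0 : ℝ) < q := by linarith
    exact_mod_cast this
  refine ⟨fun α h => not_inducedC5_of_isSolution hs hq h, ?_⟩
  obtain ⟨α, hα, hmin⟩ := WellFounded.has_min (InvImage.wf (supp q) wellFounded_lt)
    {α | IsSolution q s α} (exists_isSolution hs hsq)
  have hno : ¬ ∃ β, IsSolution q s β ∧ supp q β ⊂ supp q α :=
    fun ⟨β, hβ, hlt⟩ => hmin β hβ hlt
  exact ⟨α, hα, fun h => hno (hα.exists_smaller_of_induced3K1 hs hq h),
    fun h => hno (hα.exists_smaller_of_inducedC4 hs hq h),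
    fun h => hno (hα.exists_smaller_of_inducedC5plus hs hq h)⟩
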